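/- Let κ be a regular cardinal and let M ⊨ PA be a κ-like model (M has cardinality κ and every proper initial segment of M has cardinality less than κ). Then for every subset T ⊆ M, the expanded structure (M,T) satisfies the full collection scheme in the language of arithmetic with an extra unary predicate interpreted by T. -/

import Mathlib

/- A self-contained framework for formalizing results about compositional
truth predicates over models of Peano Arithmetic.

Design notes.
* The language of arithmetic L_PA = {0, S, +, ×} is represented semantically
  by the class `ArithStr`, and syntactically by a deep embedding `PTerm`/`TForm`
  of first-order formulas built from ¬, ∨, ∃ (as in the paper).  `TForm`
  additionally has atomic formulas `pr i t` for an ℕ-indexed family of extra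
  unary predicates; formulas not mentioning these (`TForm.arith`) are the
  arithmetical formulas, and formulas using only the predicate with index 0
  play the role of formulas of L_PA together with the truth predicate T.
* Provability is rendered as semantic consequence (by the completeness
  theorem); e.g. `PAproves φ` says that φ holds in every model of PA, and
  conservativity statements are phrased accordingly.
* The arithmetization of syntax (formulas representing "x is a sentence",
  "y = ¬x", the truth-restriction dpt(x) ≤ c, the provability predicate of PA,
  etc.) is packaged in the structure `Coding`, whose fields are actual
  arithmetical formulas together with correctness conditions tying them, on
  standard (numeral) arguments in every model of PA, to the genuine syntactic
  operations on `TForm` via a concrete Gödel numbering `TForm.code`. -/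

namespace CTPaper

/-! ## Arithmetic structures -/

class ArithStr (M : Type) where
  zero : M
  succ : M → M
  add : M → M → M
  mul : M → M → M

def azero (M : Type) [ArithStr M] : M := ArithStr.zero
def asucc {M : Type} [ArithStr M] : M → M := ArithStr.succ
def aadd {M : Type} [ArithStr M] : M → M → M := ArithStr.add
def amul {M : Type} [ArithStr M] : M → M → M := ArithStr.mul

instance : ArithStr ℕ := ⟨0, Nat.succ, (· + ·), (· * ·)⟩

/-- The ordering of a model of arithmetic, defined from addition. -/
def mlt {M : Type} [ArithStr M] (x y : M) : Prop := ∃ z : M, aadd x (asucc z) = y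

def mle {M : Type} [ArithStr M] (x y : M) : Prop := mlt x y ∨ x = y

/-- The standard numerals of a model. -/
def numeral (M : Type) [ArithStr M] : ℕ → M
  | 0 => azero M
  | n + 1 => asucc (numeral M n)

/-! ## Syntax: terms and formulas of L_PA with extra unary predicates -/

inductive PTerm : Type
  | var : ℕ → PTerm
  | zero : PTerm
  | succ : PTerm → PTerm
  | add : PTerm → PTerm → PTerm
  | mul : PTerm → PTerm → PTerm

namespace PTerm

def fv : PTerm → Finset ℕ
  | var n => {n}
  | zero => ∅
  | succ t => t.fv
  | add s t => s.fv ∪ t.fv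
  | mul s t => s.fv ∪ t.fv

/-- A concrete Gödel numbering of terms. -/
def code : PTerm → ℕ
  | var n => Nat.pair 0 n
  | zero => Nat.pair 1 0
  | succ t => Nat.pair 2 t.code
  | add s t => Nat.pair 3 (Nat.pair s.code t.code)
  | mul s t => Nat.pair 4 (Nat.pair s.code t.code)

def subst (σ : ℕ → PTerm) : PTerm → PTerm
  | var n => σ n
  | zero => zero
  | succ t => succ (t.subst σ)
  | add s t => add (s.subst σ) (t.subst σ)
  | mul s t => mul (s.subst σ) (t.subst σ)

def evalM (M : Type) [ArithStr M] (ρ : ℕ → M) : PTerm → M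
  | var n => ρ n
  | zero => azero M
  | succ t => asucc (t.evalM M ρ)
  | add s t => aadd (s.evalM M ρ) (t.evalM M ρ)
  | mul s t => amul (s.evalM M ρ) (t.evalM M ρ)

/-- The value of a (closed) term in the standard model. -/
def nval (t : PTerm) : ℕ := t.evalM ℕ (fun _ => 0)

end PTerm

/-- The numeral terms. -/
def pnum : ℕ → PTerm
  | 0 => PTerm.zero
  | n + 1 => PTerm.succ (pnum n)

inductive TForm : Type
  | eq : PTerm → PTerm → TForm
  | pr : ℕ → PTerm → TForm
  | not : TForm → TForm
  | or : TForm → TForm → TForm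
  | ex : ℕ → TForm → TForm

namespace TForm

def imp (φ ψ : TForm) : TForm := or (not φ) ψ
def and (φ ψ : TForm) : TForm := not (or (not φ) (not ψ))
def all (v : ℕ) (φ : TForm) : TForm := not (ex v (not φ))

/-- Free variables. -/
def fv : TForm → Finset ℕ
  | eq s t => s.fv ∪ t.fv
  | pr _ t => t.fv
  | not φ => φ.fv
  | or φ ψ => φ.fv ∪ ψ.fv
  | ex v φ => φ.fv.erase v

/-- All variables (free or bound). -/
def vars : TForm → Finset ℕ
  | eq s t => s.fv ∪ t.fv
  | pr _ t => t.fv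
  | not φ => φ.vars
  | or φ ψ => φ.vars ∪ ψ.vars
  | ex v φ => insert v φ.vars

/-- `φ.arith` means φ is a formula of pure L_PA (no extra predicates). -/
def arith : TForm → Prop
  | eq _ _ => True
  | pr _ _ => False
  | not φ => φ.arith
  | or φ ψ => φ.arith ∧ ψ.arith
  | ex _ φ => φ.arith

/-- Syntactic depth: maximal nesting of connectives and quantifiers. -/
def depth : TForm → ℕ
  | eq _ _ => 0
  | pr _ _ => 0
  | not φ => φ.depth + 1
  | or φ ψ => max φ.depth ψ.depth + 1
  | ex _ φ => φ.depth + 1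

/-- A concrete Gödel numbering of formulas. -/
def code : TForm → ℕ
  | eq s t => Nat.pair 0 (Nat.pair s.code t.code)
  | pr i t => Nat.pair 1 (Nat.pair i t.code)
  | not φ => Nat.pair 2 φ.code
  | or φ ψ => Nat.pair 3 (Nat.pair φ.code ψ.code)
  | ex v φ => Nat.pair 4 (Nat.pair v φ.code)

/-- Simultaneous substitution of terms for free variables. -/
def subst (σ : ℕ → PTerm) : TForm → TForm
  | eq s t => eq (s.subst σ) (t.subst σ)
  | pr i t => pr i (t.subst σ)
  | not φ => not (φ.subst σ)
  | or φ ψ => or (φ.subst σ) (ψ.subst σ)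
  | ex v φ => ex v (φ.subst (Function.update σ v (PTerm.var v)))

/-- Substitution of the numeral of `k` for the variable `v`. -/
def substNum (φ : TForm) (v k : ℕ) : TForm :=
  φ.subst (fun w => if w = v then pnum k else PTerm.var w)

/-- Tarskian satisfaction in an arithmetic structure `M`, with the extra
unary predicates interpreted by the family `P`. -/
def Realize (M : Type) [ArithStr M] (P : ℕ → Set M) : TForm → (ℕ → M) → Prop
  | eq s t, ρ => s.evalM M ρ = t.evalM M ρ
  | pr i t, ρ => t.evalM M ρ ∈ P i
  | not φ, ρ => ¬ φ.Realize M P ρ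
  | or φ ψ, ρ => φ.Realize M P ρ ∨ ψ.Realize M P ρ
  | ex v φ, ρ => ∃ a : M, φ.Realize M P (Function.update ρ v a)

/-- Satisfaction relativized to a subset `S ⊆ M` (i.e. satisfaction in the
substructure with universe `S`): quantifiers range over `S` only. -/
def RealizeOn (M : Type) [ArithStr M] (S : Set M) (P : ℕ → Set M) : TForm → (ℕ → M) → Prop
  | eq s t, ρ => s.evalM M ρ = t.evalM M ρ
  | pr i t, ρ => t.evalM M ρ ∈ P i
  | not φ, ρ => ¬ φ.RealizeOn M S P ρ
  | or φ ψ, ρ => φ.RealizeOn M S P ρ ∨ ψ.RealizeOn M S P ρ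
  | ex v φ, ρ => ∃ a ∈ S, φ.RealizeOn M S P (Function.update ρ v a)

end TForm

/-- The empty interpretation of the extra predicates, used for purely
arithmetical formulas. -/
def Pemp (M : Type) : ℕ → Set M := fun _ => ∅

/-- The interpretation making every extra predicate the truth predicate `T`
(arithmetical formulas + the predicate T). -/
def PT {M : Type} (T : Set M) : ℕ → Set M := fun _ => T

/-- Two extra predicates: index 0 is `T`, all other indices are `I`. -/
def P2 {M : Type} (T I : Set M) : ℕ → Set M := fun i => if i = 0 then T else I

/-- Evaluation environment from a list (positions beyond the list get 0). -/
def env (M : Type) [ArithStr M] (l : List M) : ℕ → M := fun n => l.getD n (azero M)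

/-- Satisfaction of an arithmetical formula at a list of arguments. -/
def aSat (M : Type) [ArithStr M] (φ : TForm) (l : List M) : Prop :=
  φ.Realize M (Pemp M) (env M l)

def aSatOn (M : Type) [ArithStr M] (S : Set M) (φ : TForm) (l : List M) : Prop :=
  φ.RealizeOn M S (Pemp M) (env M l)

/-! ## Schemes: induction and collection -/

/-- The induction scheme, for formulas in the class `Q`, with the extra
predicates interpreted by `P`; parameters enter through `ρ`. -/
def SatIndFor (M : Type) [ArithStr M] (P : ℕ → Set M) (Q : TForm → Prop) : Prop :=
  ∀ φ : TForm, Q φ → ∀ (v : ℕ) (ρ : ℕ → M),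
    φ.Realize M P (Function.update ρ v (azero M)) →
    (∀ x : M, φ.Realize M P (Function.update ρ v x) →
      φ.Realize M P (Function.update ρ v (asucc x))) →
    ∀ x : M, φ.Realize M P (Function.update ρ v x)

/-- The collection scheme ∀x<a ∃y φ(x,y) → ∃b ∀x<a ∃y<b φ(x,y), for formulas
in the class `Q`, with extra predicates `P`; parameters enter through `ρ`. -/
def SatCollFor (M : Type) [ArithStr M] (P : ℕ → Set M) (Q : TForm → Prop) : Prop :=
  ∀ φ : TForm, Q φ → ∀ (x y : ℕ), x ≠ y → ∀ (ρ : ℕ → M) (a : M),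
    (∀ u : M, mlt u a → ∃ w : M,
      φ.Realize M P (Function.update (Function.update ρ x u) y w)) →
    ∃ b : M, ∀ u : M, mlt u a → ∃ w : M, mlt w b ∧
      φ.Realize M P (Function.update (Function.update ρ x u) y w)

def SatInd (M : Type) [ArithStr M] (P : ℕ → Set M) : Prop :=
  SatIndFor M P (fun _ => True)

def SatColl (M : Type) [ArithStr M] (P : ℕ → Set M) : Prop :=
  SatCollFor M P (fun _ => True)

/-- Induction scheme relativized to a substructure `S`. -/
def SatIndForOn (M : Type) [ArithStr M] (S : Set M) (P : ℕ → Set M) (Q : TForm → Prop) : Prop :=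
  ∀ φ : TForm, Q φ → ∀ (v : ℕ) (ρ : ℕ → M), (∀ i, ρ i ∈ S) →
    φ.RealizeOn M S P (Function.update ρ v (azero M)) →
    (∀ x ∈ S, φ.RealizeOn M S P (Function.update ρ v x) →
      φ.RealizeOn M S P (Function.update ρ v (asucc x))) →
    ∀ x ∈ S, φ.RealizeOn M S P (Function.update ρ v x)

/-- Collection scheme relativized to a substructure `S`. -/
def SatCollForOn (M : Type) [ArithStr M] (S : Set M) (P : ℕ → Set M) (Q : TForm → Prop) : Prop :=
  ∀ φ : TForm, Q φ → ∀ (x y : ℕ), x ≠ y → ∀ (ρ : ℕ → M), (∀ i, ρ i ∈ S) →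
    ∀ a ∈ S,
    (∀ u ∈ S, mlt u a → ∃ w ∈ S,
      φ.RealizeOn M S P (Function.update (Function.update ρ x u) y w)) →
    ∃ b ∈ S, ∀ u ∈ S, mlt u a → ∃ w ∈ S, mlt w b ∧
      φ.RealizeOn M S P (Function.update (Function.update ρ x u) y w)

/-! ## Peano Arithmetic (semantically) -/

/-- Models of PA: the finitely many basic (Robinson) axioms together with the
full induction scheme for arithmetical formulas. -/
def IsPAModel (M : Type) [ArithStr M] : Prop :=
  (∀ x : M, asucc x ≠ azero M) ∧
  (∀ x y : M, asucc x = asucc y → x = y) ∧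
  (∀ x : M, aadd x (azero M) = x) ∧
  (∀ x y : M, aadd x (asucc y) = asucc (aadd x y)) ∧
  (∀ x : M, amul x (azero M) = azero M) ∧
  (∀ x y : M, amul x (asucc y) = aadd (amul x y) x) ∧
  SatIndFor M (Pemp M) TForm.arith

/-- PA-provability, rendered via the completeness theorem as truth in all
models of PA. -/
def PAproves (φ : TForm) : Prop :=
  ∀ (M : Type) [ArithStr M], IsPAModel M → ∀ ρ : ℕ → M, φ.Realize M (Pemp M) ρ

/-- The relativized version of `IsPAModel`: `S` is a substructure (containing
0 and closed under S, +, ×) which satisfies the PA axioms. -/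
def IsPAModelOn (M : Type) [ArithStr M] (S : Set M) : Prop :=
  azero M ∈ S ∧ (∀ x ∈ S, asucc x ∈ S) ∧
  (∀ x ∈ S, ∀ y ∈ S, aadd x y ∈ S ∧ amul x y ∈ S) ∧
  (∀ x ∈ S, asucc x ≠ azero M) ∧
  (∀ x ∈ S, ∀ y ∈ S, asucc x = asucc y → x = y) ∧
  (∀ x ∈ S, aadd x (azero M) = x) ∧
  (∀ x ∈ S, ∀ y ∈ S, aadd x (asucc y) = asucc (aadd x y)) ∧
  (∀ x ∈ S, amul x (azero M) = azero M) ∧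
  (∀ x ∈ S, ∀ y ∈ S, amul x (asucc y) = aadd (amul x y) x) ∧
  SatIndForOn M S (Pemp M) TForm.arith

/-! ## The arithmetical hierarchy -/

/-- A canonical "x < t" formula: ∃w (x + S w = t), with `w` fresh. -/
def tlt (s t : PTerm) : TForm :=
  let w := (s.fv ∪ t.fv).sup id + 1
  TForm.ex w (TForm.eq (PTerm.add s (PTerm.succ (PTerm.var w))) t)

/-- Δ₀ formulas: built from atoms by boolean connectives and bounded
quantification (in the language including the extra predicates). -/
inductive IsD0 : TForm → Prop
  | eq (s t : PTerm) : IsD0 (TForm.eq s t)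
  | pr (i : ℕ) (t : PTerm) : IsD0 (TForm.pr i t)
  | not {φ} : IsD0 φ → IsD0 (TForm.not φ)
  | or {φ ψ} : IsD0 φ → IsD0 ψ → IsD0 (TForm.or φ ψ)
  | bdex (v : ℕ) (t : PTerm) {φ} : v ∉ t.fv → IsD0 φ →
      IsD0 (TForm.ex v (TForm.and (tlt (PTerm.var v) t) φ))

mutual
  inductive IsSigmaT : ℕ → TForm → Prop
    | ofD0 {n : ℕ} {φ : TForm} : IsD0 φ → IsSigmaT n φ
    | ofPi {n : ℕ} {φ : TForm} : IsPiT n φ → IsSigmaT (n + 1) φ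
    | ex {n : ℕ} (v : ℕ) {φ : TForm} : IsSigmaT (n + 1) φ → IsSigmaT (n + 1) (TForm.ex v φ)
  inductive IsPiT : ℕ → TForm → Prop
    | ofD0 {n : ℕ} {φ : TForm} : IsD0 φ → IsPiT n φ
    | ofSigma {n : ℕ} {φ : TForm} : IsSigmaT n φ → IsPiT (n + 1) φ
    | all {n : ℕ} (v : ℕ) {φ : TForm} : IsPiT (n + 1) φ → IsPiT (n + 1) (TForm.all v φ)
end

/-! ## Structural equivalence of sentences -/

/-- Normalization of a term: each maximal variable-free subterm is replaced by
the numeral of its value; remaining (bound) variables are renamed by ρ. -/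
def tnorm (ρ : ℕ → ℕ) : PTerm → PTerm
  | PTerm.var n => PTerm.var (ρ n)
  | PTerm.zero => pnum 0
  | PTerm.succ t =>
      if (PTerm.succ t).fv = ∅ then pnum (PTerm.succ t).nval else PTerm.succ (tnorm ρ t)
  | PTerm.add s t =>
      if (PTerm.add s t).fv = ∅ then pnum (PTerm.add s t).nval
      else PTerm.add (tnorm ρ s) (tnorm ρ t)
  | PTerm.mul s t =>
      if (PTerm.mul s t).fv = ∅ then pnum (PTerm.mul s t).nval
      else PTerm.mul (tnorm ρ s) (tnorm ρ t)

/-- Normalization of a formula: bound variables are renamed canonically (the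
variable bound at nesting level d is renamed to d) and maximal closed terms
are replaced by the numerals of their values. -/
def fnorm (ρ : ℕ → ℕ) (d : ℕ) : TForm → TForm
  | TForm.eq s t => TForm.eq (tnorm ρ s) (tnorm ρ t)
  | TForm.pr i t => TForm.pr i (tnorm ρ t)
  | TForm.not φ => TForm.not (fnorm ρ d φ)
  | TForm.or φ ψ => TForm.or (fnorm ρ d φ) (fnorm ρ d ψ)
  | TForm.ex v φ => TForm.ex d (fnorm (Function.update ρ v d) (d + 1) φ)

/-- Structural equivalence of two arithmetical sentences: they arise from a
common structural template by renaming bound variables and substituting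
sequences of closed terms with (pointwise) equal values; equivalently, they
have equal canonical normal forms. -/
def strEquiv (φ ψ : TForm) : Prop :=
  φ.arith ∧ ψ.arith ∧ φ.fv = ∅ ∧ ψ.fv = ∅ ∧ fnorm id 0 φ = fnorm id 0 ψ

/-- `tmEquiv χ ψ`: χ and ψ are obtained from one and the same formula by
substituting sequences of closed terms with equal values (the relation in the
term-extensionality axiom of CT⁻). -/
def tmEquiv (χ ψ : TForm) : Prop :=
  ∃ (φ : TForm) (σ τ : ℕ → PTerm), φ.arith ∧
    (∀ v ∈ φ.fv, (σ v).fv = ∅ ∧ (τ v).fv = ∅ ∧ (σ v).nval = (τ v).nval) ∧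
    χ = φ.subst σ ∧ ψ = φ.subst τ

/-! ## Ordinal notations for the Kotlarski–Ratajczyk theorem -/

/-- ω_n(k):  ω_0(k) = k, ω_{m+1}(k) = ω^{ω_m(k)}. -/
noncomputable def wtow : ℕ → ℕ → Ordinal
  | 0, k => (k : Ordinal)
  | n + 1, k => Ordinal.omega0 ^ (wtow n k)

/-- ε_α, the α-th fixed point of ξ ↦ ω^ξ. -/
noncomputable def epsilonOrd (a : Ordinal) : Ordinal :=
  Ordinal.deriv (fun x => Ordinal.omega0 ^ x) a

/-! ## The coding of syntax -/

/-- An arithmetization of syntax: arithmetical formulas representing the basic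
syntactic (and proof-theoretic) notions, together with correctness conditions
tying them, at standard arguments, to the actual operations on `TForm` via
the Gödel numbering `TForm.code`.   Variables 0,1,2,3 are used as the
argument places of these formulas. -/
structure Coding where
  sentF : TForm        -- x is (the code of) an arithmetical sentence
  dptF : TForm         -- y is the syntactic depth of the formula x
  atomF : TForm        -- x is an atomic sentence (a closed equation)
  atomTrueF : TForm    -- x is a true atomic sentence
  negF : TForm         -- y = ¬x
  disjF : TForm        -- z = (x ∨ y)
  exF : TForm          -- x is an existential sentence ∃v φ
  instF : TForm        -- (e, k, s): e = ∃v φ and s = φ(num k / v)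
  formOneF : TForm     -- x is a formula with at most one free variable
  subNumF : TForm      -- (f, k, s): s = f(num k) (f with at most one free var)
  subTwoF : TForm      -- (f, k, l, s): s = f(num k, num l) (f with two free vars)
  substAsgnF : TForm   -- (f, α, s): α is an assignment for f and s = f[α]
  tmEqF : TForm        -- x, y arise from one formula by substituting closed
                       -- term sequences with equal values
  strEqF : TForm       -- x ≈ y (structural equivalence)
  prPAF : TForm        -- x is PA-provable
  prfPAF : TForm       -- (p, x): p is a PA-proof of x
  occF : TForm         -- (x, p): the formula x occurs in the proof p
  ordLtF : TForm       -- (x, y): x ≺ y as codes of ordinal notations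
  epsOrd : ℕ → ℕ → ℕ   -- the code of the ordinal ε_{ω_n(k)}
  ordVal : ℕ → Ordinal -- the decoding of ordinal notations
  arith_all : sentF.arith ∧ dptF.arith ∧ atomF.arith ∧ atomTrueF.arith ∧
    negF.arith ∧ disjF.arith ∧ exF.arith ∧ instF.arith ∧ formOneF.arith ∧
    subNumF.arith ∧ subTwoF.arith ∧ substAsgnF.arith ∧ tmEqF.arith ∧
    strEqF.arith ∧ prPAF.arith ∧ prfPAF.arith ∧ occF.arith ∧ ordLtF.arith
  fv_all : sentF.fv ⊆ {0} ∧ dptF.fv ⊆ {0, 1} ∧ atomF.fv ⊆ {0} ∧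
    atomTrueF.fv ⊆ {0} ∧ negF.fv ⊆ {0, 1} ∧ disjF.fv ⊆ {0, 1, 2} ∧
    exF.fv ⊆ {0} ∧ instF.fv ⊆ {0, 1, 2} ∧ formOneF.fv ⊆ {0} ∧
    subNumF.fv ⊆ {0, 1, 2} ∧ subTwoF.fv ⊆ {0, 1, 2, 3} ∧
    substAsgnF.fv ⊆ {0, 1, 2} ∧ tmEqF.fv ⊆ {0, 1} ∧ strEqF.fv ⊆ {0, 1} ∧
    prPAF.fv ⊆ {0} ∧ prfPAF.fv ⊆ {0, 1} ∧ occF.fv ⊆ {0, 1} ∧ ordLtF.fv ⊆ {0, 1}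
  sent_spec : ∀ (M : Type) [ArithStr M], IsPAModel M → ∀ n : ℕ,
    (aSat M sentF [numeral M n] ↔ ∃ φ : TForm, φ.arith ∧ φ.fv = ∅ ∧ φ.code = n)
  dpt_spec : ∀ (M : Type) [ArithStr M], IsPAModel M → ∀ φ : TForm, φ.arith →
    ∀ y : M, (aSat M dptF [numeral M φ.code, y] ↔ y = numeral M φ.depth)
  atom_spec : ∀ (M : Type) [ArithStr M], IsPAModel M → ∀ n : ℕ,
    (aSat M atomF [numeral M n] ↔
      ∃ s t : PTerm, s.fv = ∅ ∧ t.fv = ∅ ∧ (TForm.eq s t).code = n)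
  atomTrue_spec : ∀ (M : Type) [ArithStr M], IsPAModel M → ∀ n : ℕ,
    (aSat M atomTrueF [numeral M n] ↔
      ∃ s t : PTerm, s.fv = ∅ ∧ t.fv = ∅ ∧ (TForm.eq s t).code = n ∧ s.nval = t.nval)
  neg_spec : ∀ (M : Type) [ArithStr M], IsPAModel M →
    ∀ φ : TForm, φ.arith → φ.fv = ∅ → ∀ y : M,
    (aSat M negF [numeral M φ.code, y] ↔ y = numeral M (TForm.not φ).code)
  disj_spec : ∀ (M : Type) [ArithStr M], IsPAModel M →
    ∀ φ ψ : TForm, φ.arith → ψ.arith → φ.fv = ∅ → ψ.fv = ∅ → ∀ z : M,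
    (aSat M disjF [numeral M φ.code, numeral M ψ.code, z] ↔
      z = numeral M (TForm.or φ ψ).code)
  ex_spec : ∀ (M : Type) [ArithStr M], IsPAModel M → ∀ n : ℕ,
    (aSat M exF [numeral M n] ↔ ∃ (v : ℕ) (φ : TForm),
      (TForm.ex v φ).arith ∧ (TForm.ex v φ).fv = ∅ ∧ (TForm.ex v φ).code = n)
  inst_spec : ∀ (M : Type) [ArithStr M], IsPAModel M → ∀ (v : ℕ) (φ : TForm),
    (TForm.ex v φ).arith → (TForm.ex v φ).fv = ∅ → ∀ (k : ℕ) (s : M),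
    (aSat M instF [numeral M (TForm.ex v φ).code, numeral M k, s] ↔
      s = numeral M (φ.substNum v k).code)
  formOne_spec : ∀ (M : Type) [ArithStr M], IsPAModel M → ∀ n : ℕ,
    (aSat M formOneF [numeral M n] ↔
      ∃ (φ : TForm) (v : ℕ), φ.arith ∧ φ.fv ⊆ {v} ∧ φ.code = n)
  subNum_spec : ∀ (M : Type) [ArithStr M], IsPAModel M → ∀ (φ : TForm) (v : ℕ),
    φ.arith → φ.fv ⊆ {v} → ∀ (k : ℕ) (s : M),
    (aSat M subNumF [numeral M φ.code, numeral M k, s] ↔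
      s = numeral M (φ.substNum v k).code)
  subTwo_spec : ∀ (M : Type) [ArithStr M], IsPAModel M → ∀ (φ : TForm) (v w : ℕ),
    φ.arith → v < w → φ.fv ⊆ {v, w} → ∀ (k l : ℕ) (s : M),
    (aSat M subTwoF [numeral M φ.code, numeral M k, numeral M l, s] ↔
      s = numeral M ((φ.substNum v k).substNum w l).code)
  tmEq_spec : ∀ (M : Type) [ArithStr M], IsPAModel M →
    ∀ φ ψ : TForm, φ.arith → ψ.arith → φ.fv = ∅ → ψ.fv = ∅ →
    (aSat M tmEqF [numeral M φ.code, numeral M ψ.code] ↔ tmEquiv φ ψ)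
  strEq_spec : ∀ (M : Type) [ArithStr M], IsPAModel M →
    ∀ φ ψ : TForm, φ.arith → ψ.arith → φ.fv = ∅ → ψ.fv = ∅ →
    (aSat M strEqF [numeral M φ.code, numeral M ψ.code] ↔ strEquiv φ ψ)
  pr_specN : ∀ φ : TForm, φ.arith → φ.fv = ∅ →
    (aSat ℕ prPAF [φ.code] ↔ PAproves φ)
  pr_spec_up : ∀ φ : TForm, φ.arith → φ.fv = ∅ → PAproves φ →
    ∀ (M : Type) [ArithStr M], IsPAModel M → aSat M prPAF [numeral M φ.code]
  prf_pr : ∀ (M : Type) [ArithStr M], IsPAModel M → ∀ x : M,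
    (aSat M prPAF [x] ↔ ∃ p : M, aSat M prfPAF [p, x])
  ordLt_sound : ∀ a b : ℕ, aSat ℕ ordLtF [a, b] → ordVal a < ordVal b
  ordLt_complete : ∀ (b : ℕ) (β : Ordinal), β < ordVal b →
    ∃ a : ℕ, aSat ℕ ordLtF [a, b] ∧ ordVal a = β
  eps_spec : ∀ n k : ℕ, ordVal (epsOrd n k) = epsilonOrd (wtow n k)

/-! ## Truth theories, semantically -/

/-- `dptIn C x X` (in `M`): the depth of `x` belongs to `X`. -/
def dptIn (C : Coding) {M : Type} [ArithStr M] (x : M) (X : Set M) : Prop :=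
  ∃ d : M, aSat M C.dptF [x, d] ∧ d ∈ X

/-- `(M,T) ⊨ CT⁻`: `M ⊨ PA` and `T` is a compositional truth predicate for the
(internal) arithmetical sentences of `M`. -/
def CTminus (C : Coding) (M : Type) [ArithStr M] (T : Set M) : Prop :=
  IsPAModel M ∧
  (∀ x ∈ T, aSat M C.sentF [x]) ∧
  (∀ x : M, aSat M C.atomF [x] → (x ∈ T ↔ aSat M C.atomTrueF [x])) ∧
  (∀ x y : M, aSat M C.negF [x, y] → (y ∈ T ↔ x ∉ T)) ∧
  (∀ x y z : M, aSat M C.disjF [x, y, z] → (z ∈ T ↔ (x ∈ T ∨ y ∈ T))) ∧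
  (∀ e : M, aSat M C.exF [e] →
    (e ∈ T ↔ ∃ x s : M, aSat M C.instF [e, x, s] ∧ s ∈ T)) ∧
  (∀ x y : M, aSat M C.tmEqF [x, y] → (x ∈ T ↔ y ∈ T))

/-- `(M,T) ⊨ CT⁻↾X`: the truth predicate applies only to sentences whose
depth lies in `X` and the compositional clauses hold for such sentences. -/
def CTrestr (C : Coding) (M : Type) [ArithStr M] (T : Set M) (X : Set M) : Prop :=
  IsPAModel M ∧
  (∀ x ∈ T, aSat M C.sentF [x] ∧ dptIn C x X) ∧
  (∀ x : M, aSat M C.atomF [x] → dptIn C x X →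
    (x ∈ T ↔ aSat M C.atomTrueF [x])) ∧
  (∀ x y : M, aSat M C.negF [x, y] → dptIn C y X → (y ∈ T ↔ x ∉ T)) ∧
  (∀ x y z : M, aSat M C.disjF [x, y, z] → dptIn C z X →
    (z ∈ T ↔ (x ∈ T ∨ y ∈ T))) ∧
  (∀ e : M, aSat M C.exF [e] → dptIn C e X →
    (e ∈ T ↔ ∃ x s : M, aSat M C.instF [e, x, s] ∧ s ∈ T)) ∧
  (∀ x y : M, aSat M C.tmEqF [x, y] → (x ∈ T ↔ y ∈ T))

/-- The relativization of `CTminus` to a substructure `S ⊆ M`. -/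
def CTminusOn (C : Coding) (M : Type) [ArithStr M] (S : Set M) (T : Set M) : Prop :=
  IsPAModelOn M S ∧
  (∀ x ∈ S, x ∈ T → aSatOn M S C.sentF [x]) ∧
  (∀ x ∈ S, aSatOn M S C.atomF [x] → (x ∈ T ↔ aSatOn M S C.atomTrueF [x])) ∧
  (∀ x ∈ S, ∀ y ∈ S, aSatOn M S C.negF [x, y] → (y ∈ T ↔ x ∉ T)) ∧
  (∀ x ∈ S, ∀ y ∈ S, ∀ z ∈ S, aSatOn M S C.disjF [x, y, z] →
    (z ∈ T ↔ (x ∈ T ∨ y ∈ T))) ∧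
  (∀ e ∈ S, aSatOn M S C.exF [e] →
    (e ∈ T ↔ ∃ x ∈ S, ∃ s ∈ S, aSatOn M S C.instF [e, x, s] ∧ s ∈ T)) ∧
  (∀ x ∈ S, ∀ y ∈ S, aSatOn M S C.tmEqF [x, y] → (x ∈ T ↔ y ∈ T))

/-- The restriction T_c of the truth predicate to sentences of depth ≤ c. -/
def Tres (C : Coding) (M : Type) [ArithStr M] (T : Set M) (c : M) : Set M :=
  {x | x ∈ T ∧ ∃ d : M, aSat M C.dptF [x, d] ∧ mle d c}

/-- The scheme of local collection: each restricted truth predicate T_c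
satisfies full collection. -/
def LocColl (C : Coding) (M : Type) [ArithStr M] (T : Set M) : Prop :=
  ∀ c : M, SatColl M (PT (Tres C M T c))

/-- The scheme of local induction: each restricted truth predicate T_c
satisfies full induction. -/
def LocInd (C : Coding) (M : Type) [ArithStr M] (T : Set M) : Prop :=
  ∀ c : M, SatInd M (PT (Tres C M T c))

/-- Structural regularity: structurally equivalent sentences get the same
truth value. -/
def StrReg (C : Coding) (M : Type) [ArithStr M] (T : Set M) : Prop :=
  ∀ x y : M, aSat M C.strEqF [x, y] → (x ∈ T ↔ y ∈ T)

/-- The global reflection principle: everything PA-provable is true. -/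
def GR (C : Coding) (M : Type) [ArithStr M] (T : Set M) : Prop :=
  ∀ x : M, aSat M C.prPAF [x] → x ∈ T

/-- Internal induction (INT): every set defined by a (possibly nonstandard)
arithmetical formula with at most one free variable, via the truth predicate,
satisfies induction. -/
def IntAx (C : Coding) (M : Type) [ArithStr M] (T : Set M) : Prop :=
  ∀ f : M, aSat M C.formOneF [f] →
    (∃ s : M, aSat M C.subNumF [f, azero M, s] ∧ s ∈ T) →
    (∀ x : M, (∃ s : M, aSat M C.subNumF [f, x, s] ∧ s ∈ T) →
      (∃ s : M, aSat M C.subNumF [f, asucc x, s] ∧ s ∈ T)) →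
    ∀ x : M, ∃ s : M, aSat M C.subNumF [f, x, s] ∧ s ∈ T

/-- An initial segment of a model. -/
def InitSeg (M : Type) [ArithStr M] (I : Set M) : Prop :=
  ∀ x ∈ I, ∀ y : M, mlt y x → y ∈ I

/-- The initial segment [0, c]. -/
def segLe (M : Type) [ArithStr M] (c : M) : Set M := {x | mle x c}

/-- The disintegration of a truth predicate: `disint C M T' f` is the set of
(codes of) assignments α such that the sentence f[α] is true. -/
def disint (C : Coding) (M : Type) [ArithStr M] (T' : Set M) (f : M) : Set M :=
  {a | ∃ s : M, aSat M C.substAsgnF [f, a, s] ∧ s ∈ T'}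

/-! ## Embeddings and extensions -/

/-- An elementary map for arithmetical formulas. -/
def ArithElem (M N : Type) [ArithStr M] [ArithStr N] (h : M → N) : Prop :=
  ∀ φ : TForm, φ.arith → ∀ ρ : ℕ → M,
    (φ.Realize M (Pemp M) ρ ↔ φ.Realize N (Pemp N) (h ∘ ρ))

/-- An elementary map for the language with the truth predicate. -/
def TElem (M N : Type) [ArithStr M] [ArithStr N] (T : Set M) (T' : Set N)
    (h : M → N) : Prop :=
  ∀ (φ : TForm) (ρ : ℕ → M), (φ.Realize M (PT T) ρ ↔ φ.Realize N (PT T') (h ∘ ρ))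

def ArithHom (M N : Type) [ArithStr M] [ArithStr N] (h : M → N) : Prop :=
  h (azero M) = azero N ∧ (∀ x : M, h (asucc x) = asucc (h x)) ∧
  (∀ x y : M, h (aadd x y) = aadd (h x) (h y)) ∧
  (∀ x y : M, h (amul x y) = amul (h x) (h y))

/-- `h : M → N` realizes `N` as an end-extension of `M`: an embedding of
structures such that every element of `N` not in the image lies above all
of `M`. -/
def IsEndExt (M N : Type) [ArithStr M] [ArithStr N] (h : M → N) : Prop :=
  Function.Injective h ∧ ArithHom M N h ∧
  ∀ y : N, y ∉ Set.range h → ∀ x : M, mlt (h x) y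

/-! ## Recursive saturation -/

/-- `RecSatP M P`: the structure `(M, P)` is recursively saturated.  A
recursive type (given by a computable characteristic function `f` on Gödel
codes) in the variable 0, with finitely many parameters (`ρ 1, …, ρ k`),
which is finitely satisfiable, is realized. -/
def RecSatP (M : Type) [ArithStr M] (P : ℕ → Set M) : Prop :=
  ∀ (f : ℕ → Bool), Computable f → ∀ (k : ℕ) (ρ : ℕ → M),
    (∀ s : Finset TForm,
      (∀ φ ∈ s, f φ.code = true ∧ φ.fv ⊆ Finset.range (k + 1)) →
      ∃ a : M, ∀ φ ∈ s, φ.Realize M P (Function.update ρ 0 a)) →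
    ∃ a : M, ∀ φ : TForm, f φ.code = true → φ.fv ⊆ Finset.range (k + 1) →
      φ.Realize M P (Function.update ρ 0 a)

/-- Recursive saturation of the arithmetical reduct. -/
def RecSatArith (M : Type) [ArithStr M] : Prop := RecSatP M (Pemp M)

/-! ## Arithmetized consistency and transfinite induction -/

/-- The canonical contradiction 0 = S0. -/
def contraForm : TForm := TForm.eq PTerm.zero (PTerm.succ PTerm.zero)

/-- Con(PA): the sentence ¬ Pr_PA(⌜0 = S0⌝). -/
def conPA (C : Coding) : TForm :=
  TForm.not (C.prPAF.subst
    (fun u => if u = 0 then pnum contraForm.code else PTerm.var u))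

/-- Substitution instance `C.ordLtF(s, t)`. -/
def ordLtApp (C : Coding) (s t : PTerm) : TForm :=
  C.ordLtF.subst (fun u => if u = 0 then s else if u = 1 then t else PTerm.var u)

/-- The transfinite induction axiom TI(a, φ) up to the ordinal notation `a`,
for an arithmetical formula φ with free variable 0. -/
def TIax (C : Coding) (a : ℕ) (φ : TForm) : TForm :=
  let b := ((φ.vars ∪ C.ordLtF.vars).sup id) + 1
  let g := b + 1
  let φat : ℕ → TForm := fun w =>
    φ.subst (fun u => if u = 0 then PTerm.var w else PTerm.var u)
  TForm.imp
    (TForm.all b (TForm.imp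
      (TForm.all g (TForm.imp (ordLtApp C (PTerm.var g) (PTerm.var b)) (φat g)))
      (φat b)))
    (TForm.all g (TForm.imp (ordLtApp C (PTerm.var g) (pnum a)) (φat g)))

end CTPaper
namespace CTPaper

section PAModel

variable {M : Type} [ArithStr M]

theorem IsPAModel.induction (hPA : IsPAModel M) {φ : TForm} (hφ : φ.arith) (ρ : ℕ → M)
    {p : M → Prop} (hp : ∀ m, φ.Realize M (Pemp M) (Function.update ρ 0 m) ↔ p m)
    (h0 : p (azero M)) (hS : ∀ m, p m → p (asucc m)) (m : M) : p m :=
  (hp m).1 (hPA.2.2.2.2.2.2 φ hφ 0 ρ ((hp _).2 h0)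
    (fun x hx => (hp _).2 (hS x ((hp x).1 hx))) m)

theorem IsPAModel.aadd_zero (hPA : IsPAModel M) (x : M) : aadd x (azero M) = x :=
  hPA.2.2.1 x

theorem IsPAModel.aadd_succ (hPA : IsPAModel M) (x y : M) :
    aadd x (asucc y) = asucc (aadd x y) :=
  hPA.2.2.2.1 x y

theorem IsPAModel.zero_aadd (hPA : IsPAModel M) (x : M) : aadd (azero M) x = x := by
  refine hPA.induction (φ := .eq (.add .zero (.var 0)) (.var 0)) trivial (fun _ => x)
    (p := fun x => aadd (azero M) x = x) (fun m => ?_) (hPA.aadd_zero _) (fun m hm => ?_) x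
  · simp [TForm.Realize, PTerm.evalM]
  · rw [hPA.aadd_succ, hm]

theorem IsPAModel.succ_aadd (hPA : IsPAModel M) (x y : M) :
    aadd (asucc x) y = asucc (aadd x y) := by
  refine hPA.induction
    (φ := .eq (.add (.succ (.var 1)) (.var 0)) (.succ (.add (.var 1) (.var 0)))) trivial
    (fun _ => x) (p := fun y => aadd (asucc x) y = asucc (aadd x y)) (fun m => ?_) ?_
    (fun m hm => ?_) y
  · simp [TForm.Realize, PTerm.evalM]
  · rw [hPA.aadd_zero, hPA.aadd_zero]
  · rw [hPA.aadd_succ, hm, hPA.aadd_succ]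

theorem IsPAModel.eq_zero_or_exists_succ (hPA : IsPAModel M) (x : M) :
    x = azero M ∨ ∃ y, x = asucc y := by
  refine hPA.induction
    (φ := .or (.eq (.var 0) .zero) (.ex 1 (.eq (.var 0) (.succ (.var 1))))) ⟨trivial, trivial⟩
    (fun _ => x) (p := fun x => x = azero M ∨ ∃ y, x = asucc y) (fun m => ?_) (Or.inl rfl)
    (fun m _ => Or.inr ⟨m, rfl⟩) x
  simp [TForm.Realize, PTerm.evalM]

theorem IsPAModel.mlt_or_exists_aadd_eq (hPA : IsPAModel M) (x y : M) :
    mlt x y ∨ ∃ z, aadd y z = x := by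
  refine hPA.induction
    (φ := .or (.ex 2 (.eq (.add (.var 1) (.succ (.var 2))) (.var 0)))
      (.ex 2 (.eq (.add (.var 0) (.var 2)) (.var 1)))) ⟨trivial, trivial⟩
    (fun _ => x) (p := fun y => mlt x y ∨ ∃ z, aadd y z = x) (fun m => ?_)
    (Or.inr ⟨x, hPA.zero_aadd x⟩) ?_ y
  · simp [TForm.Realize, PTerm.evalM, mlt]
  · rintro y (⟨z, hz⟩ | ⟨z, hz⟩)
    · exact Or.inl ⟨asucc z, by rw [hPA.aadd_succ, hz]⟩
    · rcases hPA.eq_zero_or_exists_succ z with rfl | ⟨w, rfl⟩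
      · refine Or.inl ⟨azero M, ?_⟩
        rw [hPA.aadd_succ, hPA.aadd_zero, ← hz, hPA.aadd_zero]
      · exact Or.inr ⟨w, by rw [hPA.succ_aadd, ← hPA.aadd_succ, hz]⟩

theorem IsPAModel.mlt_succ_of_not_mlt (hPA : IsPAModel M) {x y : M} (h : ¬ mlt x y) :
    mlt y (asucc x) := by
  obtain ⟨z, hz⟩ := (hPA.mlt_or_exists_aadd_eq x y).resolve_left h
  exact ⟨z, by rw [hPA.aadd_succ, hz]⟩

/-- Regularity of `κ` means that no proper initial segment of a `κ`-like model
has a function into the model with unbounded range. -/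
theorem IsPAModel.exists_forall_mlt_of_kappaLike (hPA : IsPAModel M) {κ : Cardinal}
    (hκ : κ.IsRegular) (hcard : Cardinal.mk M = κ)
    (hseg : ∀ a : M, Cardinal.mk {x : M // mlt x a} < κ) (a : M)
    (f : {x : M // mlt x a} → M) : ∃ b, ∀ u, mlt (f u) b := by
  by_contra! h
  have hU : (⋃ u, {w : M | mlt w (asucc (f u))}) = Set.univ := by
    refine Set.eq_univ_of_forall fun b => ?_
    obtain ⟨u, hu⟩ := h b
    exact Set.mem_iUnion.2 ⟨u, hPA.mlt_succ_of_not_mlt hu⟩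
  have hlt : Cardinal.mk (⋃ u, {w : M | mlt w (asucc (f u))} : Set M) < κ :=
    (Cardinal.card_iUnion_lt_iff_forall_of_isRegular hκ (hseg a)).2
      fun u => hseg (asucc (f u))
  rw [hU, Cardinal.mk_univ, hcard] at hlt
  exact hlt.false

end PAModel

/-- If `κ` is a regular cardinal and `M ⊨ PA` is κ-like
(|M| = κ while every proper initial segment has size < κ), then for every
`T ⊆ M` the structure `(M,T)` satisfies the full collection scheme in the
language of arithmetic with an extra unary predicate for `T`. -/
theorem kappaLike_satisfies_collection (κ : Cardinal) (hκ : κ.IsRegular)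
    (M : Type) [ArithStr M] (hPA : IsPAModel M)
    (hcard : Cardinal.mk M = κ)
    (hseg : ∀ a : M, Cardinal.mk {x : M // mlt x a} < κ)
    (T : Set M) :
    SatColl M (PT T) := by
  intro φ _ x y _ ρ a h
  choose f hf using h
  obtain ⟨b, hb⟩ := hPA.exists_forall_mlt_of_kappaLike hκ hcard hseg a fun u => f u.1 u.2
  exact ⟨b, fun u hu => ⟨f u hu, hb ⟨u, hu⟩, hf u hu⟩⟩

end CTPaper
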